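/- Let μ₁,…,μ_N be absolutely continuous probability measures on ℝ such that supp(μ_k) = [l_k,r_k] and the density of μ_k is nonincreasing on [l_k,r_k] for each k. Then there exists a probability measure γ on ℝ^N with k-th marginal μ_k for each k and concentrated on the hyperplane {x₁+⋯+x_N = C}, where C = 𝔼(μ₁)+⋯+𝔼(μ_N), if and only if r_k − l_k ≤ C − (l₁+⋯+l_N) for all k = 1,…,N. -/

import Mathlib

open MeasureTheory

/-- The (closed) support of a Borel measure on ℝ: points all of whose open neighborhoods
have positive measure. -/
def msupport (μ : Measure ℝ) : Set ℝ :=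
  {x | ∀ U : Set ℝ, IsOpen U → x ∈ U → μ U ≠ 0}

/-- The uniform distribution on the segment from `c` to `c + s` (a Dirac mass if `s = 0`). -/
noncomputable def segUnif (c s : ℝ) : Measure ℝ :=
  (volume.restrict (Set.Icc (0 : ℝ) 1)).map (fun x => c + s * x)

instance isProbabilityMeasure_restrict_Icc :
    IsProbabilityMeasure (volume.restrict (Set.Icc (0 : ℝ) 1)) :=
  ⟨by simp⟩

instance isProbabilityMeasure_segUnif (c s : ℝ) : IsProbabilityMeasure (segUnif c s) :=
  Measure.isProbabilityMeasure_map (by fun_prop)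

theorem segUnif_real (c s : ℝ) {A : Set ℝ} (hA : MeasurableSet A) :
    (segUnif c s).real A = ∫ x in (0 : ℝ)..1, A.indicator 1 (c + s * x) := by
  rw [← integral_indicator_one hA, segUnif, integral_map (by fun_prop)
    (by exact ((measurable_one.indicator hA).aestronglyMeasurable)),
    integral_Icc_eq_integral_Ioc, intervalIntegral.integral_of_le zero_le_one]

theorem intervalIntegrable_indicator_one {A : Set ℝ} (hA : MeasurableSet A) (a b : ℝ) :
    IntervalIntegrable (A.indicator (1 : ℝ → ℝ)) volume a b :=
  (intervalIntegrable_const (c := (1 : ℝ))).mono_fun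
    ((measurable_one.indicator hA).aestronglyMeasurable)
    (Filter.Eventually.of_forall fun x => by
      by_cases h : x ∈ A <;> simp [h])

theorem mul_segUnif_real (c s : ℝ) {A : Set ℝ} (hA : MeasurableSet A) :
    s * (segUnif c s).real A = ∫ x in c..(c + s), A.indicator 1 x := by
  rw [segUnif_real c s hA, intervalIntegral.mul_integral_comp_add_mul]
  simp

/-- A uniform distribution splits at an intermediate point. -/
theorem segUnif_split (c s w : ℝ) {A : Set ℝ} (hA : MeasurableSet A) :
    (segUnif c s).real A = w * (segUnif c (w * s)).real A
      + (1 - w) * (segUnif (c + w * s) ((1 - w) * s)).real A := by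
  by_cases hs : s = 0
  · subst hs; simp; ring
  · have h1 := mul_segUnif_real c s hA
    have h2 := mul_segUnif_real c (w * s) hA
    have h3 := mul_segUnif_real (c + w * s) ((1 - w) * s) hA
    have h4 := intervalIntegral.integral_add_adjacent_intervals
      (intervalIntegrable_indicator_one hA c (c + w * s))
      (intervalIntegrable_indicator_one hA (c + w * s) (c + w * s + (1 - w) * s))
    have h5 : c + w * s + (1 - w) * s = c + s := by ring
    rw [h5] at h3 h4
    apply mul_left_cancel₀ hs
    rw [h1, ← h4, ← h2, ← h3]; ring

theorem segUnif_reverse (c s : ℝ) {A : Set ℝ} (hA : MeasurableSet A) :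
    (segUnif (c + s) (-s)).real A = (segUnif c s).real A := by
  by_cases hs : s = 0
  · subst hs; simp
  · have h1 := mul_segUnif_real c s hA
    have h2 := mul_segUnif_real (c + s) (-s) hA
    rw [intervalIntegral.integral_symm] at h2
    simp only [add_neg_cancel_right] at h2
    apply mul_left_cancel₀ hs
    linarith

section Coupling

variable {ι : Type*} [Fintype ι]

/-- The measures `μ k` have a coupling under which the sum of the coordinates equals `C`
outside of an event of probability at most `ε`. -/
def AlmostMixable (C ε : ℝ) (μ : ι → Measure ℝ) : Prop :=
  ∃ γ : Measure (ι → ℝ), IsProbabilityMeasure γ ∧ (∀ k, γ.map (fun x => x k) = μ k) ∧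
    γ.real {x | ∑ i, x i ≠ C} ≤ ε

theorem almostMixable_one (C : ℝ) (μ : ι → Measure ℝ) [∀ k, IsProbabilityMeasure (μ k)] :
    AlmostMixable C 1 μ :=
  ⟨Measure.pi μ, inferInstance, fun k => (measurePreserving_eval μ k).map_eq,
    measureReal_le_one⟩

theorem AlmostMixable.mono {C ε ε' : ℝ} {μ : ι → Measure ℝ} (h : AlmostMixable C ε μ)
    (hε : ε ≤ ε') : AlmostMixable C ε' μ := by
  obtain ⟨γ, h1, h2, h3⟩ := h
  exact ⟨γ, h1, h2, h3.trans hε⟩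

theorem real_sum_smul {α J : Type*} [MeasurableSpace α] [Fintype J] (μ : J → Measure α)
    [∀ j, IsFiniteMeasure (μ j)] {p : J → ℝ} (hp : ∀ j, 0 ≤ p j) (A : Set α) :
    (∑ j, ENNReal.ofReal (p j) • μ j).real A = ∑ j, p j * (μ j).real A := by
  simp only [Measure.real, Measure.coe_finsetSum, Finset.sum_apply, Measure.smul_apply,
    smul_eq_mul]
  rw [ENNReal.toReal_sum fun j _ => ENNReal.mul_ne_top (by simp) (by simp)]
  exact Finset.sum_congr rfl fun j _ => by
    rw [ENNReal.toReal_mul, ENNReal.toReal_ofReal (hp j)]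

theorem isProbabilityMeasure_sum_smul {α J : Type*} [MeasurableSpace α] [Fintype J]
    (μ : J → Measure α) [∀ j, IsProbabilityMeasure (μ j)] {p : J → ℝ} (hp : ∀ j, 0 ≤ p j)
    (hp1 : ∑ j, p j = 1) : IsProbabilityMeasure (∑ j, ENNReal.ofReal (p j) • μ j) := by
  constructor
  simp [← ENNReal.ofReal_sum_of_nonneg fun j _ => hp j, hp1]

theorem measure_ext_real {α : Type*} [MeasurableSpace α] {μ ν : Measure α}
    [IsFiniteMeasure μ] [IsFiniteMeasure ν]
    (h : ∀ A, MeasurableSet A → μ.real A = ν.real A) : μ = ν :=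
  Measure.ext fun A hA => (measureReal_eq_measureReal_iff).1 (h A hA)

theorem AlmostMixable.convexCombo {J : Type*} [Fintype J] {C : ℝ} {ε p : J → ℝ}
    {μ : J → ι → Measure ℝ} {κ : ι → Measure ℝ} [∀ k, IsProbabilityMeasure (κ k)]
    (h : ∀ j, AlmostMixable C (ε j) (μ j)) (hp : ∀ j, 0 ≤ p j) (hp1 : ∑ j, p j = 1)
    (hκ : ∀ k A, MeasurableSet A → (κ k).real A = ∑ j, p j * (μ j k).real A) :
    AlmostMixable C (∑ j, p j * ε j) κ := by
  choose γ hγ m e using h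
  have hm : ∀ (γ : Measure (ι → ℝ)) k {A : Set ℝ}, MeasurableSet A →
      (γ.map (fun x => x k)).real A = γ.real ((fun x => x k) ⁻¹' A) := fun γ k A hA =>
    map_measureReal_apply (measurable_pi_apply k) hA
  have hprob := isProbabilityMeasure_sum_smul γ hp hp1
  refine ⟨_, hprob, fun k => ?_, ?_⟩
  · have := Measure.isProbabilityMeasure_map (μ := ∑ j, ENNReal.ofReal (p j) • γ j)
      (measurable_pi_apply (X := fun _ : ι => ℝ) k).aemeasurable
    refine measure_ext_real fun A hA => ?_
    rw [hm _ k hA, real_sum_smul _ hp, hκ k A hA]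
    exact Finset.sum_congr rfl fun j _ => by rw [← m, hm _ k hA]
  · rw [real_sum_smul _ hp]
    exact Finset.sum_le_sum fun j _ => mul_le_mul_of_nonneg_left (e j) (hp j)

/-- Segments whose slopes sum to zero are mixable. -/
theorem almostMixable_segUnif {C : ℝ} {c s : ι → ℝ} (hc : ∑ k, c k = C)
    (hs : ∑ k, s k = 0) : AlmostMixable C 0 (fun k => segUnif (c k) (s k)) := by
  refine ⟨(volume.restrict (Set.Icc (0 : ℝ) 1)).map (fun x k => c k + s k * x),
    Measure.isProbabilityMeasure_map (by fun_prop), fun k => ?_, ?_⟩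
  · rw [Measure.map_map (by fun_prop) (by fun_prop)]; rfl
  · rw [map_measureReal_apply (by fun_prop)]
    · have : ∀ x : ℝ, ∑ k, (c k + s k * x) = C := fun x => by
        rw [Finset.sum_add_distrib, ← Finset.sum_mul, hc, hs]; ring
      simp [this]
    · exact (measurableSet_eq_fun (by fun_prop) measurable_const).compl

/-- Nonnegative numbers, each at most half of their sum, can be grouped into three groups, each
with at most half of the total sum. -/
theorem exists_three_groups {t : ι → ℝ} {D : ℝ} (h0 : ∀ k, 0 ≤ t k) (hD : ∀ k, t k ≤ D)
    (hsum : ∑ k, t k = 2 * D) :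
    ∃ g : ι → Fin 3, ∀ i, ∑ k with g k = i, t k ≤ D := by
  classical
  have hD0 : 0 ≤ D := by
    have := Finset.sum_nonneg fun k (_ : k ∈ Finset.univ) => h0 k
    linarith
  obtain ⟨G, hG, hmax⟩ := Finset.exists_max_image
    (Finset.univ.filter fun G : Finset ι => ∑ k ∈ G, t k ≤ D) Finset.card ⟨∅, by simpa⟩
  simp only [Finset.mem_filter, Finset.mem_univ, true_and] at hG hmax
  by_cases hu : G = Finset.univ
  · have hz : D = 0 := by rw [hu, hsum] at hG; linarith
    refine ⟨fun _ => 0, fun i => ?_⟩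
    calc ∑ k with (0 : Fin 3) = i, t k ≤ ∑ k, t k :=
          Finset.sum_le_sum_of_subset_of_nonneg (Finset.subset_univ _) fun k _ _ => h0 k
      _ ≤ D := by rw [hsum, hz]; simp
  · obtain ⟨i₀, hi₀⟩ : ∃ i, i ∉ G := by
      by_contra! h
      exact hu (Finset.eq_univ_iff_forall.2 h)
    have hlt : D < ∑ k ∈ insert i₀ G, t k := by
      by_contra! h
      have := hmax _ h
      rw [Finset.card_insert_of_notMem hi₀] at this
      omega
    have hcompl : ∑ k ∈ (insert i₀ G)ᶜ, t k ≤ D := by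
      have := Finset.sum_add_sum_compl (insert i₀ G) t
      linarith
    refine ⟨fun k => if k ∈ G then 0 else if k = i₀ then 1 else 2, fun i => ?_⟩
    fin_cases i
    · convert hG using 2
      ext k
      by_cases h1 : k ∈ G <;> by_cases h2 : k = i₀ <;> simp [h1, h2]
    · convert hD i₀ using 1
      rw [← Finset.sum_singleton t i₀]
      congr 1
      ext k
      by_cases h1 : k ∈ G <;> by_cases h2 : k = i₀ <;> simp_all
    · convert hcompl using 2
      ext k
      by_cases h1 : k ∈ G <;> by_cases h2 : k = i₀ <;> simp_all

theorem exists_triangle_weights {α β γ : ℝ} (hα : 0 ≤ α) (hβ : 0 ≤ β) (hγ : 0 ≤ γ) :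
    ∃ w₀ w₁ w₂ v₀ v₁ v₂ : ℝ, 0 ≤ w₀ ∧ 0 ≤ w₁ ∧ 0 ≤ w₂ ∧ w₀ + w₁ + w₂ = 1 ∧
      v₀ * (β + γ) = γ ∧ v₁ * (α + γ) = α ∧ v₂ * (α + β) = β ∧
      w₂ = (w₁ + w₂) * v₀ ∧ w₁ = (w₁ + w₀) * v₁ ∧ w₀ = (w₀ + w₂) * v₂ := by
  by_cases hZ : α * β + β * γ + γ * α = 0
  · have h1 : α * β = 0 := by nlinarith [mul_nonneg hα hβ, mul_nonneg hβ hγ, mul_nonneg hγ hα]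
    have h2 : β * γ = 0 := by nlinarith [mul_nonneg hα hβ, mul_nonneg hβ hγ, mul_nonneg hγ hα]
    have h3 : γ * α = 0 := by nlinarith [mul_nonneg hα hβ, mul_nonneg hβ hγ, mul_nonneg hγ hα]
    have : (β = 0 ∧ γ = 0) ∨ (α = 0 ∧ γ = 0) ∨ (α = 0 ∧ β = 0) := by
      rcases mul_eq_zero.1 h1 with h | h <;> rcases mul_eq_zero.1 h2 with h' | h' <;>
        rcases mul_eq_zero.1 h3 with h'' | h'' <;> tauto
    rcases this with ⟨rfl, rfl⟩ | ⟨rfl, rfl⟩ | ⟨rfl, rfl⟩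
    · exact ⟨0, 1, 0, 0, 1, 0, by norm_num⟩
    · exact ⟨1, 0, 0, 0, 0, 1, by norm_num⟩
    · exact ⟨0, 0, 1, 1, 0, 0, by norm_num⟩
  · have hZ' : 0 < α * β + β * γ + γ * α := lt_of_le_of_ne (by positivity) (Ne.symm hZ)
    have n1 : β + γ ≠ 0 := fun h => hZ (by
      have : β = 0 := by linarith
      have : γ = 0 := by linarith
      simp [*])
    have n2 : α + γ ≠ 0 := fun h => hZ (by
      have : α = 0 := by linarith
      have : γ = 0 := by linarith
      simp [*])
    have n3 : α + β ≠ 0 := fun h => hZ (by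
      have : α = 0 := by linarith
      have : β = 0 := by linarith
      simp [*])
    refine ⟨β * γ / (α * β + β * γ + γ * α), α * β / (α * β + β * γ + γ * α),
      γ * α / (α * β + β * γ + γ * α), γ / (β + γ), α / (α + γ), β / (α + β),
      by positivity, by positivity, by positivity, ?_, ?_, ?_, ?_, ?_, ?_, ?_⟩
    · rw [← add_div, ← add_div, div_eq_one_iff_eq hZ]; ring
    all_goals field_simp
    all_goals ring

/-- **Joint mixability of uniform distributions**: uniform distributions whose lengths satisfy the
polygon inequality are mixable. -/
theorem almostMixable_uniform {C D : ℝ} {c t : ι → ℝ} (h0 : ∀ k, 0 ≤ t k)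
    (hD : ∀ k, t k ≤ D) (hsum : ∑ k, t k = 2 * D) (hc : ∑ k, c k + D = C) :
    AlmostMixable C 0 (fun k => segUnif (c k) (t k)) := by
  classical
  obtain ⟨g, hg⟩ := exists_three_groups h0 hD hsum
  set T : Fin 3 → ℝ := fun i => ∑ k with g k = i, t k
  have hT : ∀ F : Fin 3 → ℝ, ∑ k, t k * F (g k) = T 0 * F 0 + T 1 * F 1 + T 2 * F 2 := by
    intro F
    rw [← Fin.sum_univ_three (fun i => T i * F i), ← Finset.sum_fiberwise _ g]
    refine Finset.sum_congr rfl fun i _ => ?_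
    rw [Finset.sum_mul]
    refine Finset.sum_congr rfl fun k hk => ?_
    rw [(Finset.mem_filter.1 hk).2]
  have hT1 : T 0 + T 1 + T 2 = 2 * D := by
    have := hT fun _ => 1
    simp only [mul_one] at this
    linarith
  obtain ⟨w₀, w₁, w₂, v₀, v₁, v₂, hw₀, hw₁, hw₂, hw, hv₀, hv₁, hv₂, e₀, e₁, e₂⟩ :=
    exists_triangle_weights (sub_nonneg.2 (hg 0)) (sub_nonneg.2 (hg 1)) (sub_nonneg.2 (hg 2))
  change v₀ * (D - T 1 + (D - T 2)) = D - T 2 at hv₀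
  change v₁ * (D - T 0 + (D - T 2)) = D - T 0 at hv₁
  change v₂ * (D - T 0 + (D - T 1)) = D - T 1 at hv₂
  have hv₀' : v₀ * T 0 = D - T 2 := by rw [← hv₀]; linear_combination v₀ * hT1
  have hv₁' : v₁ * T 1 = D - T 0 := by rw [← hv₁]; linear_combination v₁ * hT1
  have hv₂' : v₂ * T 2 = D - T 1 := by rw [← hv₂]; linear_combination v₂ * hT1
  have seg : ∀ P Q : Fin 3 → ℝ, T 0 * P 0 + T 1 * P 1 + T 2 * P 2 = D →
      T 0 * Q 0 + T 1 * Q 1 + T 2 * Q 2 = 0 →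
      AlmostMixable C 0 (fun k => segUnif (c k + t k * P (g k)) (t k * Q (g k))) := by
    intro P Q hP hQ
    refine almostMixable_segUnif ?_ ?_
    · rw [Finset.sum_add_distrib, hT, hP, hc]
    · rw [hT, hQ]
  let P : Fin 3 → Fin 3 → ℝ := ![![0, 1, v₂], ![1, v₁, 0], ![v₀, 0, 1]]
  let Q : Fin 3 → Fin 3 → ℝ := ![![1, v₁ - 1, -v₂], ![v₀ - 1, -v₁, 1], ![-v₀, 1, v₂ - 1]]
  have hseg : ∀ j, AlmostMixable C 0
      (fun k => segUnif (c k + t k * P j (g k)) (t k * Q j (g k))) := fun j => by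
    refine seg (P j) (Q j) ?_ ?_ <;> fin_cases j <;> simp [P, Q] <;> linarith
  have key : ∀ {c t v p q r : ℝ} {A : Set ℝ}, MeasurableSet A → p + q + r = 1 →
      r = (q + r) * v → (segUnif c t).real A = p * (segUnif c t).real A
        + q * (segUnif (c + t) (t * (v - 1))).real A
        + r * (segUnif (c + t * v) (t * -v)).real A := by
    intro c t v p q r A hA h1 h2
    have a1 := segUnif_split c t v hA
    have a2 := segUnif_reverse c (v * t) hA
    have a3 := segUnif_reverse (c + v * t) ((1 - v) * t) hA
    rw [show c + v * t + (1 - v) * t = c + t by ring,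
      show -((1 - v) * t) = t * (v - 1) by ring] at a3
    rw [show c + v * t = c + t * v by ring, show -(v * t) = t * -v by ring] at a2
    rw [a2, a3]
    have h3 : q = (q + r) * (1 - v) := by linarith
    linear_combination (q + r) * a1 - (segUnif c t).real A * h1
      - (segUnif c (v * t)).real A * h2
      - (segUnif (c + v * t) ((1 - v) * t)).real A * h3
  have := AlmostMixable.convexCombo (p := ![w₀, w₁, w₂])
    (κ := fun k => segUnif (c k) (t k)) hseg
    (fun j => by fin_cases j <;> assumption) (by simp [Fin.sum_univ_three, hw])
    (fun k A hA => by
      simp only [Fin.sum_univ_three]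
      have hk : ∀ i : Fin 3, i = 0 ∨ i = 1 ∨ i = 2 := by decide
      rcases hk (g k) with h | h | h
      · have := key (c := c k) (t := t k) hA hw e₀
        simpa [h, P, Q] using this
      · have := key (c := c k) (t := t k) (v := v₁) (p := w₂) (q := w₀) (r := w₁) hA
          (by linarith) (by linarith)
        simp only [h, P, Q]
        simp at this ⊢
        linarith
      · have := key (c := c k) (t := t k) (v := v₂) (p := w₁) (q := w₂) (r := w₀) hA
          (by linarith) (by linarith)
        simp only [h, P, Q]
        simp at this ⊢
        linarith)
  simpa using this

theorem exists_sum_eq_of_le_of_le {lo hi : ι → ℝ} {T : ℝ} (h : ∀ k, lo k ≤ hi k)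
    (hlo : ∑ k, lo k ≤ T) (hhi : T ≤ ∑ k, hi k) :
    ∃ s : ι → ℝ, (∀ k, lo k ≤ s k) ∧ (∀ k, s k ≤ hi k) ∧ ∑ k, s k = T := by
  have hcont : ContinuousOn (fun θ : ℝ => ∑ k, (lo k + θ * (hi k - lo k))) (Set.Icc 0 1) := by
    fun_prop
  obtain ⟨θ, ⟨h0, h1⟩, hθ⟩ := intermediate_value_Icc zero_le_one hcont
    (show T ∈ Set.Icc _ _ by simp [hlo, hhi])
  refine ⟨fun k => lo k + θ * (hi k - lo k), fun k => ?_, fun k => ?_, hθ⟩ <;>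
    nlinarith [h k]

theorem two_mul_le_sum_min {t : ι → ℝ} {D δ : ℝ} (h0 : ∀ k, 0 ≤ t k) (hD : 0 ≤ D)
    (hδ : 0 ≤ δ) (ht : ∀ k, t k ≤ D + δ) (hsum : ∑ k, t k = 2 * D + δ) :
    2 * D ≤ ∑ k, min (t k) D := by
  classical
  by_cases h : ∃ i j, i ≠ j ∧ D ≤ t i ∧ D ≤ t j
  · obtain ⟨i, j, hij, hi, hj⟩ := h
    calc 2 * D = ∑ k ∈ {i, j}, min (t k) D := by
          rw [Finset.sum_pair hij, min_eq_right hi, min_eq_right hj]; ring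
      _ ≤ _ := Finset.sum_le_sum_of_subset_of_nonneg (Finset.subset_univ _)
          fun k _ _ => le_min (h0 k) hD
  · push Not at h
    by_cases h' : ∃ i, D ≤ t i
    · obtain ⟨i, hi⟩ := h'
      have h1 := Finset.add_sum_erase Finset.univ t (Finset.mem_univ i)
      have h2 := Finset.add_sum_erase Finset.univ (fun k => min (t k) D) (Finset.mem_univ i)
      have h3 : ∑ k ∈ Finset.univ.erase i, min (t k) D = ∑ k ∈ Finset.univ.erase i, t k :=
        Finset.sum_congr rfl fun k hk =>
          min_eq_left (h i k (Finset.ne_of_mem_erase hk).symm hi).le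
      rw [← h2, h3]
      simp only [min_eq_right hi]
      linarith [ht i]
    · push Not at h'
      rw [Finset.sum_congr rfl fun k _ => min_eq_left (h' k).le]
      linarith

/-- A mixture of the uniform distributions on the segments `[0, t j]`. -/
noncomputable def uniformMixture {J : Type*} [Fintype J] (q t : J → ℝ) : Measure ℝ :=
  ∑ j, ENNReal.ofReal (q j) • segUnif 0 (t j)

theorem uniformMixture_real {J : Type*} [Fintype J] {q t : J → ℝ} (hq : ∀ j, 0 ≤ q j)
    (A : Set ℝ) : (uniformMixture q t).real A = ∑ j, q j * (segUnif 0 (t j)).real A :=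
  real_sum_smul _ hq A

/-- Weights and endpoints of mixtures of uniform distributions on subintervals `[0, t]` of
`[0, C]` whose means add up to `C`. -/
structure IsBalanced {J : Type*} [Fintype J] (C : ℝ) (q t : ι → J → ℝ) : Prop where
  nonneg : ∀ k j, 0 ≤ q k j
  sum_eq_one : ∀ k, ∑ j, q k j = 1
  endpoint_nonneg : ∀ k j, 0 ≤ t k j
  endpoint_le : ∀ k j, t k j ≤ C
  sum_mean : ∑ k, ∑ j, q k j * t k j = 2 * C

theorem IsBalanced.isProbabilityMeasure {J : Type*} [Fintype J] {C : ℝ} {q t : ι → J → ℝ}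
    (h : IsBalanced C q t) (k : ι) : IsProbabilityMeasure (uniformMixture (q k) (t k)) :=
  isProbabilityMeasure_sum_smul _ (h.nonneg k) (h.sum_eq_one k)

/-- Removing a uniform distribution on an upper subinterval from a uniform distribution. -/
theorem exists_upper_removal {p q s t : ℝ} (hp : 0 < p) (hq : 0 < q) (hpq : p + q = 1)
    (hs : p * t ≤ s) (hst : s ≤ t) (hs0 : 0 ≤ s) :
    ∃ w, 0 ≤ w ∧ w ≤ 1 ∧
      t = p * (2 * (t - s) + s) + q * (w * t + (1 - w) * (t - s)) ∧
      ∀ A, MeasurableSet A → (segUnif 0 t).real A = p * (segUnif (t - s) s).real A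
        + q * (w * (segUnif 0 t).real A + (1 - w) * (segUnif 0 (t - s)).real A) := by
  rcases hs0.eq_or_lt with rfl | hs0
  · have : t = 0 := le_antisymm (by nlinarith) hst
    subst this
    refine ⟨1, zero_le_one, le_rfl, by simp, fun A _ => ?_⟩
    simp only [sub_self]
    linear_combination -(segUnif 0 0).real A * hpq
  · have ht : 0 < t := hs0.trans_le hst
    have hw : q * ((s - p * t) / (q * s)) = 1 - p * t / s := by field_simp
    refine ⟨(s - p * t) / (q * s), div_nonneg (by linarith) (by positivity), ?_, ?_, ?_⟩
    · rw [div_le_one (by positivity)]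
      nlinarith
    · generalize (s - p * t) / (q * s) = w at *
      have : p * t / s * s = p * t := by field_simp
      linear_combination (-s) * hw + this - (t - s) * hpq
    · intro A hA
      have h := segUnif_split 0 t ((t - s) / t) hA
      have e1 : (t - s) / t * t = t - s := by field_simp
      have e2 : (1 - (t - s) / t) * t = s := by field_simp; ring
      rw [e1, e2, zero_add] at h
      generalize (s - p * t) / (q * s) = w at *
      have e3 : p * t / s * (1 - (t - s) / t) = p := by field_simp; ring
      have e4 : p * t / s * ((t - s) / t) = q * (1 - w) := by
        rw [show q * (1 - w) = q - (1 - p * t / s) by rw [← hw]; ring,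
          show q = 1 - p by linarith]
        field_simp
        ring
      linear_combination (p * t / s) * h - (segUnif 0 t).real A * hw
        + (segUnif (t - s) s).real A * e3 + (segUnif 0 (t - s)).real A * e4

/-- Removing a uniform distribution on a lower subinterval from a uniform distribution. -/
theorem exists_lower_removal {p q s t : ℝ} (hp : 0 < p) (hpq : p + q = 1)
    (ht0 : 0 ≤ t) (hs : q * t ≤ s) (hst : s ≤ t) :
    ∃ ν : Measure ℝ, IsProbabilityMeasure ν ∧ ∀ A, MeasurableSet A →
      (segUnif 0 t).real A = q * (segUnif 0 s).real A + p * ν.real A := by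
  rcases ht0.eq_or_lt with rfl | ht0
  · have : s = 0 := le_antisymm hst (by linarith)
    subst this
    exact ⟨segUnif 0 0, inferInstance, fun A _ => by
      linear_combination -(segUnif 0 0).real A * hpq⟩
  · have hv : q ≤ s / t := by rwa [le_div_iff₀ ht0]
    have hv1 : s / t ≤ 1 := by rwa [div_le_one ht0]
    have hc : ∀ j, 0 ≤ (![(s / t - q) / p, (1 - s / t) / p] : Fin 2 → ℝ) j := by
      intro j
      fin_cases j
      · exact div_nonneg (by linarith) hp.le
      · exact div_nonneg (by linarith) hp.le
    let μ : Fin 2 → Measure ℝ := ![segUnif 0 s, segUnif s (t - s)]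
    have hμ : ∀ j, IsProbabilityMeasure (μ j) := by
      intro j; fin_cases j <;> simp only [μ] <;> exact isProbabilityMeasure_segUnif _ _
    refine ⟨_, isProbabilityMeasure_sum_smul μ hc ?_, fun A hA => ?_⟩
    · rw [Fin.sum_univ_two]
      simp only [Matrix.cons_val_zero, Matrix.cons_val_one]
      rw [← add_div, div_eq_one_iff_eq hp.ne']
      linarith
    · rw [real_sum_smul _ hc, Fin.sum_univ_two]
      have h := segUnif_split 0 t (s / t) hA
      have e1 : s / t * t = s := by field_simp
      have e2 : (1 - s / t) * t = t - s := by field_simp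
      rw [e1, e2, zero_add] at h
      simp only [Matrix.cons_val_zero, Matrix.cons_val_one, μ]
      rw [h]
      field_simp
      ring

/-- The tuple of uniform distributions on `[0, t j]`, where the distribution with index `k` is
replaced by a mixture with weights `p` and `q` of those on `[0, t k]` and `[0, b]`, has means
adding up to `C`. -/
structure IsEdge (C : ℝ) (k : ι) (t : ι → ℝ) (b p q : ℝ) (κ : ι → Measure ℝ) : Prop where
  endpoint_nonneg : ∀ j, 0 ≤ t j
  endpoint_le : ∀ j, t j ≤ C
  le_right : t k ≤ b
  right_le : b ≤ C
  left_weight_nonneg : 0 ≤ p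
  right_weight_nonneg : 0 ≤ q
  weights : p + q = 1
  sum_mean : ∑ j, t j + q * (b - t k) = 2 * C
  isProbabilityMeasure : ∀ j, IsProbabilityMeasure (κ j)
  eq_of_ne : ∀ j, j ≠ k → κ j = segUnif 0 (t j)
  real_eq : ∀ A, MeasurableSet A →
    (κ k).real A = p * (segUnif 0 (t k)).real A + q * (segUnif 0 b).real A

theorem sum_ite_eq_left [DecidableEq ι] (k : ι) (x : ℝ) (f : ι → ℝ) :
    ∑ j, (if j = k then x else f j) = x + (∑ j, f j - f k) := by
  rw [← Finset.add_sum_erase _ _ (Finset.mem_univ k), if_pos rfl,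
    ← Finset.add_sum_erase _ f (Finset.mem_univ k), add_sub_cancel_left]
  congr 1
  exact Finset.sum_congr rfl fun j hj => if_neg (Finset.ne_of_mem_erase hj)

theorem IsEdge.almostMixable_left_weight {C b p q : ℝ} {k : ι} {t : ι → ℝ}
    {κ : ι → Measure ℝ} (h : IsEdge C k t b p q κ) (hp : 0 < p) (hq : 0 < q) :
    AlmostMixable C p κ := by
  classical
  have := h.isProbabilityMeasure
  have hlr := h.le_right
  have hrl := h.right_le
  have hw := h.weights
  have hsm := h.sum_mean
  have h0k := h.endpoint_nonneg k
  obtain ⟨s, hlo, hhi, hs⟩ := exists_sum_eq_of_le_of_le (T := 2 * C)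
    (lo := fun j => if j = k then b else q * t j) (hi := fun j => if j = k then b else t j)
    (fun j => by
      split_ifs
      · exact le_rfl
      · nlinarith [h.endpoint_nonneg j])
    (by
      rw [sum_ite_eq_left k b (fun j => q * t j), ← Finset.mul_sum]
      have : 2 * C - (b + (q * (2 * C - q * (b - t k)) - q * t k))
        = p * (2 * (C - b) + p * (b - t k) + t k) := by
        rw [show p = 1 - q by linarith]; ring
      have : 0 ≤ p * (2 * (C - b) + p * (b - t k) + t k) := by
        have := mul_nonneg hp.le (sub_nonneg.2 hlr)
        apply mul_nonneg hp.le
        linarith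
      rw [show ∑ j, t j = 2 * C - q * (b - t k) by linarith]
      linarith)
    (by
      rw [sum_ite_eq_left k b t]
      have := mul_nonneg hp.le (sub_nonneg.2 hlr)
      rw [show p = 1 - q by linarith] at this
      linarith)
  have hsk : s k = b := le_antisymm (by simpa using hhi k) (by simpa using hlo k)
  have hlo' : ∀ j, j ≠ k → q * t j ≤ s j := fun j hj => by simpa [hj] using hlo j
  have hhi' : ∀ j, j ≠ k → s j ≤ t j := fun j hj => by simpa [hj] using hhi j
  have hmix : AlmostMixable C 0 (fun j => segUnif 0 (s j)) := by
    refine almostMixable_uniform (c := fun _ => 0) (D := C) (fun j => ?_) (fun j => ?_) hs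
      (by simp)
    · by_cases hj : j = k
      · rw [hj, hsk]; linarith
      · exact (mul_nonneg hq.le (h.endpoint_nonneg j)).trans (hlo' j hj)
    · by_cases hj : j = k
      · rw [hj, hsk]; exact hrl
      · exact (hhi' j hj).trans (h.endpoint_le j)
  have hex : ∀ j, ∃ ν : Measure ℝ, IsProbabilityMeasure ν ∧ ∀ A, MeasurableSet A →
      (κ j).real A = q * (segUnif 0 (s j)).real A + p * ν.real A := by
    intro j
    by_cases hj : j = k
    · subst hj
      exact ⟨segUnif 0 (t j), inferInstance, fun A hA => by rw [h.real_eq A hA, hsk, add_comm]⟩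
    · rw [h.eq_of_ne j hj]
      exact exists_lower_removal hp hw (h.endpoint_nonneg j) (hlo' j hj) (hhi' j hj)
  choose ν hν hκ using hex
  have := AlmostMixable.convexCombo (J := Fin 2) (C := C) (ε := ![0, 1]) (p := ![q, p])
    (μ := fun i j => ![segUnif 0 (s j), ν j] i) (κ := κ)
    (fun i => by
      fin_cases i
      · exact hmix
      · exact almostMixable_one C ν)
    (fun i => by fin_cases i <;> simp [hp.le, hq.le]) (by simp; linarith)
    (fun j A hA => by simpa using hκ j A hA)
  simpa using this

theorem IsEdge.almostMixable_of_isBalanced {C b p q ε : ℝ} {k : ι} {t : ι → ℝ}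
    {κ : ι → Measure ℝ} (h : IsEdge C k t b p q κ) (hp : 0 < p) (hq : 0 < q)
    (hε : ∀ u v : ι → Fin 2 → ℝ, IsBalanced C u v →
      AlmostMixable C ε (fun k => uniformMixture (u k) (v k))) :
    AlmostMixable C (q * ε) κ := by
  classical
  have := h.isProbabilityMeasure
  have hlr := h.le_right
  have hrl := h.right_le
  have hw := h.weights
  have hsm := h.sum_mean
  have h0k := h.endpoint_nonneg k
  have hδ : 0 ≤ q * (b - t k) := mul_nonneg hq.le (sub_nonneg.2 hlr)
  have hδ' : 0 ≤ p * (b - t k) := mul_nonneg hp.le (sub_nonneg.2 hlr)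
  set D := C - q * (b - t k) with hD
  have hkD : t k ≤ D := by
    rw [show q = 1 - p by linarith] at hD
    linarith
  obtain ⟨s, hlo, hhi, hs⟩ := exists_sum_eq_of_le_of_le (T := 2 * D)
    (lo := fun j => if j = k then t k else p * t j) (hi := fun j => min (t j) D)
    (fun j => by
      split_ifs with hj
      · rw [hj]; exact le_min le_rfl hkD
      · refine le_min (by nlinarith [h.endpoint_nonneg j]) ?_
        have h1 := mul_le_mul_of_nonneg_left (h.endpoint_le j) hp.le
        have h2 := mul_le_mul_of_nonneg_left (show b - t k ≤ C by linarith) hq.le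
        have h3 : p * C + q * C = C := by rw [← add_mul, hw, one_mul]
        linarith)
    (by
      rw [sum_ite_eq_left k (t k) (fun j => p * t j), ← Finset.mul_sum]
      have h1 : 2 * D - (t k + (p * (2 * C - q * (b - t k)) - p * t k))
        = q * (2 * (C - b) + p * (b - t k) + t k) := by
        rw [hD, show p = 1 - q by linarith]; ring
      have h2 : 0 ≤ q * (2 * (C - b) + p * (b - t k) + t k) :=
        mul_nonneg hq.le (by linarith)
      rw [show ∑ j, t j = 2 * C - q * (b - t k) by linarith]
      linarith)
    (two_mul_le_sum_min h.endpoint_nonneg (h0k.trans hkD) hδ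
      (fun j => by rw [hD]; linarith [h.endpoint_le j]) (by rw [hD]; linarith))
  have hsk : s k = t k :=
    le_antisymm ((hhi k).trans (min_le_left _ _)) (by simpa using hlo k)
  have hlo' : ∀ j, p * t j ≤ s j := fun j => by
    by_cases hj : j = k
    · rw [hj, hsk]; nlinarith
    · simpa [hj] using hlo j
  have hst : ∀ j, s j ≤ t j := fun j => (hhi j).trans (min_le_left _ _)
  have hs0 : ∀ j, 0 ≤ s j := fun j =>
    (mul_nonneg hp.le (h.endpoint_nonneg j)).trans (hlo' j)
  have hmix : AlmostMixable C 0 (fun j => segUnif (t j - s j) (s j)) := by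
    refine almostMixable_uniform (D := D) hs0 (fun j => (hhi j).trans (min_le_right _ _)) hs ?_
    rw [Finset.sum_sub_distrib, hs]
    linarith
  choose w hw0 hw1 hmean hreal using fun j =>
    exists_upper_removal hp hq hw (hlo' j) (hst j) (hs0 j)
  let u : ι → Fin 2 → ℝ := fun j => if j = k then ![1, 0] else ![w j, 1 - w j]
  let v : ι → Fin 2 → ℝ := fun j => if j = k then ![b, b] else ![t j, t j - s j]
  have huv : ∀ f : ℝ → ℝ, ∀ j, ∑ i, u j i * f (v j i)
      = if j = k then f b else w j * f (t j) + (1 - w j) * f (t j - s j) := by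
    intro f j
    simp only [u, v]
    split_ifs <;> simp
  have hbal : IsBalanced C u v := by
    refine ⟨fun j i => ?_, fun j => ?_, fun j i => ?_, fun j i => ?_, ?_⟩
    · simp only [u]
      split_ifs
      · fin_cases i <;> simp
      · fin_cases i <;> simp [hw0, hw1]
    · simpa using huv (fun _ => 1) j
    · simp only [v]
      split_ifs
      · fin_cases i <;> simp <;> linarith
      · fin_cases i <;> simp [h.endpoint_nonneg, hst]
    · simp only [v]
      split_ifs
      · fin_cases i <;> simp <;> linarith
      · fin_cases i <;> simp [h.endpoint_le]
        linarith [h.endpoint_le j, hs0 j]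
    · have h1 := huv id
      simp only [id] at h1
      simp_rw [h1]
      rw [sum_ite_eq_left k b (fun j => w j * t j + (1 - w j) * (t j - s j)), hsk]
      have h2 := Finset.sum_congr rfl fun j (_ : j ∈ Finset.univ) => hmean j
      have h3 := hmean k
      rw [hsk] at h3
      rw [Finset.sum_add_distrib, ← Finset.mul_sum, ← Finset.mul_sum, Finset.sum_add_distrib,
        ← Finset.mul_sum, Finset.sum_sub_distrib, hs] at h2
      apply mul_left_cancel₀ hq.ne'
      linear_combination (-1) * h2 + h3 + (1 - 2 * p) * hsm + 2 * p * hD + (t k - 2 * C) * hw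
  have := AlmostMixable.convexCombo (J := Fin 2) (C := C) (ε := ![0, ε]) (p := ![p, q])
    (μ := fun i j => ![segUnif (t j - s j) (s j), uniformMixture (u j) (v j)] i) (κ := κ)
    (fun i => by
      fin_cases i
      · exact hmix
      · exact hε u v hbal)
    (fun i => by fin_cases i <;> simp [hp.le, hq.le]) (by simpa using hw)
    (fun j A hA => by
      simp only [Fin.sum_univ_two, Matrix.cons_val_zero, Matrix.cons_val_one]
      rw [uniformMixture_real (hbal.nonneg j), huv (fun x => (segUnif 0 x).real A)]
      split_ifs with hj
      · rw [hj, hsk, sub_self, h.real_eq A hA]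
      · rw [h.eq_of_ne j hj, ← hreal j A hA])
  simpa using this

theorem IsEdge.almostMixable_of_forall_isBalanced {C b p q ε : ℝ} {k : ι} {t : ι → ℝ}
    {κ : ι → Measure ℝ} (h : IsEdge C k t b p q κ) (hε0 : 0 ≤ ε) (hε1 : ε ≤ 1)
    (hε : ∀ u v : ι → Fin 2 → ℝ, IsBalanced C u v →
      AlmostMixable C ε (fun k => uniformMixture (u k) (v k))) :
    AlmostMixable C (ε * (1 - ε / 2)) κ := by
  classical
  have := h.isProbabilityMeasure
  have hw := h.weights
  have hsm := h.sum_mean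
  have hpos : 0 ≤ ε * (1 - ε / 2) := by nlinarith
  rcases h.left_weight_nonneg.eq_or_lt with hp | hp
  · have hκ : κ = fun j => segUnif 0 (if j = k then b else t j) := by
      ext1 j
      split_ifs with hj
      · subst hj
        refine measure_ext_real fun A hA => ?_
        rw [h.real_eq A hA, ← hp, show q = 1 by linarith]
        ring
      · exact h.eq_of_ne j hj
    rw [hκ]
    refine (almostMixable_uniform (D := C) (c := fun _ => 0) (fun j => ?_) (fun j => ?_) ?_
      (by simp)).mono hpos
    · split_ifs
      · exact (h.endpoint_nonneg k).trans h.le_right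
      · exact h.endpoint_nonneg j
    · split_ifs
      · exact h.right_le
      · exact h.endpoint_le j
    · rw [sum_ite_eq_left, ← hsm, show q = 1 by linarith]
      ring
  rcases h.right_weight_nonneg.eq_or_lt with hq | hq
  · have hκ : κ = fun j => segUnif 0 (t j) := by
      ext1 j
      by_cases hj : j = k
      · subst hj
        refine measure_ext_real fun A hA => ?_
        rw [h.real_eq A hA, ← hq, show p = 1 by linarith]
        ring
      · exact h.eq_of_ne j hj
    rw [hκ]
    refine (almostMixable_uniform (D := C) (c := fun _ => 0) h.endpoint_nonneg h.endpoint_le ?_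
      (by simp)).mono hpos
    rw [← hsm, ← hq]
    ring
  rcases le_total p (ε / 2) with hpε | hpε
  · exact (h.almostMixable_left_weight hp hq).mono (by nlinarith)
  · exact (h.almostMixable_of_isBalanced hp hq hε).mono (by nlinarith)

theorem exists_pos_add_mul_eq_zero {X : Type*} [Fintype X] {q d : X → ℝ} (hq : ∀ x, 0 ≤ q x)
    (hd : ∀ x, q x = 0 → d x = 0) (hneg : ∃ x, d x < 0) :
    ∃ τ > 0, (∀ x, 0 ≤ q x + τ * d x) ∧ ∃ x, q x ≠ 0 ∧ q x + τ * d x = 0 := by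
  classical
  obtain ⟨x₀, hx₀⟩ := hneg
  obtain ⟨x, hx, hmin⟩ := Finset.exists_min_image (Finset.univ.filter fun x => d x < 0)
    (fun x => q x / -d x) ⟨x₀, by simpa⟩
  simp only [Finset.mem_filter, Finset.mem_univ, true_and] at hx hmin
  have hqx : q x ≠ 0 := fun h => hx.ne (hd x h)
  have hqx' : 0 < q x := (hq x).lt_of_ne' hqx
  refine ⟨q x / -d x, div_pos hqx' (by linarith), fun y => ?_, x, hqx, ?_⟩
  · rcases lt_or_ge (d y) 0 with hy | hy
    · have := hmin y hy
      rw [le_div_iff₀ (by linarith)] at this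
      linarith
    · have := div_nonneg hqx'.le (show 0 ≤ -d x by linarith)
      have := mul_nonneg this hy
      linarith [hq y]
  · have : d x ≠ 0 := hx.ne
    field_simp
    ring

theorem exists_sum_eq_of_card_eq_one {J : Type*} [Fintype J] {q : J → ℝ}
    (hq : ∑ j, q j = 1) (h : (Finset.univ.filter fun j => q j ≠ 0).card = 1) :
    ∃ a, ∀ f : J → ℝ, ∑ j, q j * f j = f a := by
  obtain ⟨a, ha⟩ := Finset.card_eq_one.1 h
  have key : ∀ f : J → ℝ, ∑ j, q j * f j = q a * f a := fun f => by
    rw [← Finset.sum_singleton (fun j => q j * f j) a, ← ha]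
    exact (Finset.sum_filter_of_ne fun j _ hj => left_ne_zero_of_mul hj).symm
  have ha1 : q a = 1 := by simpa [hq] using (key fun _ => 1).symm
  exact ⟨a, fun f => by rw [key, ha1, one_mul]⟩

theorem exists_sum_eq_of_card_eq_two {J : Type*} [Fintype J] {q : J → ℝ} (t : J → ℝ)
    (h : (Finset.univ.filter fun j => q j ≠ 0).card = 2) :
    ∃ a b, t a ≤ t b ∧ ∀ f : J → ℝ, ∑ j, q j * f j = q a * f a + q b * f b := by
  classical
  obtain ⟨a, b, hab, hs⟩ := Finset.card_eq_two.1 h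
  have key : ∀ f : J → ℝ, ∑ j, q j * f j = q a * f a + q b * f b := fun f => by
    rw [← Finset.sum_pair (f := fun j => q j * f j) hab, ← hs]
    exact (Finset.sum_filter_of_ne fun j _ hj => left_ne_zero_of_mul hj).symm
  rcases le_total (t a) (t b) with h | h
  · exact ⟨a, b, h, key⟩
  · exact ⟨b, a, h, fun f => by rw [key, add_comm]⟩

theorem forall_eq_one_or_exists_eq_two {n : ι → ℕ} (h1 : ∀ k, 1 ≤ n k)
    (hn : ∑ k, n k ≤ Fintype.card ι + 1) :
    (∀ k, n k = 1) ∨ ∃ k, n k = 2 ∧ ∀ j, j ≠ k → n j = 1 := by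
  classical
  by_cases h : ∀ k, n k = 1
  · exact Or.inl h
  · push Not at h
    obtain ⟨k, hk⟩ := h
    refine Or.inr ⟨k, ?_⟩
    have hsum : ∑ j, (n j - 1) ≤ 1 := by
      have : ∑ j, (n j - 1) + Fintype.card ι = ∑ j, n j := by
        rw [← Finset.card_univ, Finset.card_eq_sum_ones, ← Finset.sum_add_distrib]
        exact Finset.sum_congr rfl fun j _ => Nat.sub_add_cancel (h1 j)
      omega
    have hk1 := h1 k
    have hle := Finset.single_le_sum (f := fun j => n j - 1) (fun j _ => Nat.zero_le _)
      (Finset.mem_univ k)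
    refine ⟨by omega, fun j hj => ?_⟩
    have h2 : ∑ i ∈ {k, j}, (n i - 1) ≤ ∑ i, (n i - 1) :=
      Finset.sum_le_sum_of_subset (Finset.subset_univ _)
    rw [Finset.sum_pair hj.symm] at h2
    have := h1 j
    omega

/-- Balanced mixtures reduce to edges, the extreme points of the polytope of balanced weights
being supported on at most `card ι + 1` indices. -/
theorem IsBalanced.almostMixable_of_isEdge {J : Type*} [Fintype J] {C ε : ℝ} (hε : 0 ≤ ε)
    (hedge : ∀ (k : ι) (t : ι → ℝ) (b p q : ℝ) (κ : ι → Measure ℝ), IsEdge C k t b p q κ →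
      AlmostMixable C ε κ) {q t : ι → J → ℝ} (h : IsBalanced C q t) :
    AlmostMixable C ε (fun k => uniformMixture (q k) (t k)) := by
  classical
  induction hn : (Finset.univ.filter fun x : ι × J => q x.1 x.2 ≠ 0).card
    using Nat.strong_induction_on generalizing q with
  | _ n ih =>
  have hprob := h.isProbabilityMeasure
  by_cases hcard : n ≤ Fintype.card ι + 1
  · have hcards : ∑ k, (Finset.univ.filter fun j => q k j ≠ 0).card = n := by
      rw [← hn, Finset.card_filter, Fintype.sum_prod_type]
      exact Finset.sum_congr rfl fun k _ => Finset.card_filter _ _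
    rcases forall_eq_one_or_exists_eq_two
      (n := fun k => (Finset.univ.filter fun j => q k j ≠ 0).card) (fun k => by
        rw [Nat.one_le_iff_ne_zero, Finset.card_ne_zero]
        by_contra h0
        have h1 := h.sum_eq_one k
        rw [Finset.sum_eq_zero fun j _ => ?_] at h1
        · exact zero_ne_one h1
        · by_contra hj
          exact h0 ⟨j, by simpa⟩) (hcards.trans_le hcard) with h1 | ⟨k, hk, h1⟩
    · choose a ha using fun k => exists_sum_eq_of_card_eq_one (h.sum_eq_one k) (h1 k)
      have hκ : (fun k => uniformMixture (q k) (t k)) = fun k => segUnif 0 (t k (a k)) := by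
        ext1 k
        refine measure_ext_real fun A hA => ?_
        rw [uniformMixture_real (h.nonneg k), ha k fun j => (segUnif 0 (t k j)).real A]
      rw [hκ]
      refine (almostMixable_uniform (D := C) (c := fun _ => 0)
        (fun _ => h.endpoint_nonneg _ _) (fun _ => h.endpoint_le _ _) ?_ (by simp)).mono hε
      rw [← h.sum_mean]
      exact Finset.sum_congr rfl fun k _ => (ha k (t k)).symm
    · obtain ⟨x, y, hxy, hk⟩ := exists_sum_eq_of_card_eq_two (t k) hk
      have hex : ∀ j, ∃ a, if j = k then a = x else
          ∀ f : J → ℝ, ∑ i, q j i * f i = f a := fun j => by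
        split_ifs with hj
        · exact ⟨x, rfl⟩
        · exact exists_sum_eq_of_card_eq_one (h.sum_eq_one j) (h1 j hj)
      choose a ha using hex
      have hak : a k = x := by simpa using ha k
      have ha' : ∀ j, j ≠ k → ∀ f : J → ℝ, ∑ i, q j i * f i = f (a j) := fun j hj => by
        simpa [hj] using ha j
      have hw : q k x + q k y = 1 := by
        have := hk fun _ => 1
        simpa [h.sum_eq_one k] using this.symm
      refine hedge k (fun j => t j (a j)) (t k y) (q k x) (q k y) _
        ⟨fun _ => h.endpoint_nonneg _ _, fun _ => h.endpoint_le _ _, by simpa [hak] using hxy,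
          h.endpoint_le _ _, h.nonneg _ _, h.nonneg _ _, hw, ?_, hprob, fun j hj => ?_,
          fun A hA => ?_⟩
      · rw [← h.sum_mean, ← Finset.add_sum_erase _ _ (Finset.mem_univ k),
          ← Finset.add_sum_erase _ (fun j => ∑ i, q j i * t j i) (Finset.mem_univ k),
          hk (t k), hak, Finset.sum_congr rfl fun j hj =>
            ha' j (Finset.ne_of_mem_erase hj) (t j)]
        linear_combination (-t k x) * hw
      · refine measure_ext_real fun A hA => ?_
        rw [uniformMixture_real (h.nonneg j), ha' j hj fun i => (segUnif 0 (t j i)).real A]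
      · rw [uniformMixture_real (h.nonneg k), hk fun i => (segUnif 0 (t k i)).real A, hak]
  · let L : (ι × J → ℝ) →ₗ[ℝ] (ι → ℝ) × ℝ × ({x : ι × J // q x.1 x.2 = 0} → ℝ) :=
      { toFun := fun d => (fun k => ∑ j, d (k, j), ∑ k, ∑ j, d (k, j) * t k j, fun x => d x)
        map_add' := fun d e => by
          ext <;> simp [Finset.sum_add_distrib, add_mul]
        map_smul' := fun c d => by
          ext <;> simp [Finset.mul_sum, mul_assoc] }
    have hker : LinearMap.ker L ≠ ⊥ := by
      apply LinearMap.ker_ne_bot_of_finrank_lt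
      rw [Module.finrank_prod, Module.finrank_prod, Module.finrank_fintype_fun_eq_card,
        Module.finrank_fintype_fun_eq_card, Module.finrank_fintype_fun_eq_card,
        Module.finrank_self, Fintype.card_subtype]
      have := Finset.card_filter_add_card_filter_not (s := (Finset.univ : Finset (ι × J)))
        (fun x => q x.1 x.2 = 0)
      rw [Finset.card_univ] at this
      change Finset.card (Finset.univ.filter fun x : ι × J => ¬ q x.1 x.2 = 0) = n at hn
      omega
    obtain ⟨d, hdL, hd0⟩ := (Submodule.ne_bot_iff _).1 hker
    have hL : L d = 0 := hdL
    have hrow : ∀ k, ∑ j, d (k, j) = 0 := fun k => congrFun (congrArg Prod.fst hL) k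
    have hmean : ∑ k, ∑ j, d (k, j) * t k j = 0 := congrArg (fun z => z.2.1) hL
    have hsupp : ∀ x : ι × J, q x.1 x.2 = 0 → d x = 0 := fun x hx =>
      congrFun (congrArg (fun z => z.2.2) hL) ⟨x, hx⟩
    have hneg : (∃ x, d x < 0) ∧ ∃ x, 0 < d x := by
      obtain ⟨⟨k, j⟩, hx⟩ := Function.ne_iff.1 hd0
      simp only [Pi.zero_apply] at hx
      have h1 := Finset.exists_pos_of_sum_zero_of_exists_nonzero _ (hrow k)
        ⟨j, Finset.mem_univ j, hx⟩
      have h2 := Finset.exists_pos_of_sum_zero_of_exists_nonzero (fun j => -d (k, j))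
        (s := Finset.univ) (by simp [hrow k]) ⟨j, Finset.mem_univ j, by simpa⟩
      obtain ⟨i, -, hi⟩ := h1
      obtain ⟨i', -, hi'⟩ := h2
      exact ⟨⟨_, neg_pos.1 hi'⟩, ⟨_, hi⟩⟩
    have hstep : ∀ (σ : ℝ), (∃ x, σ * d x < 0) → ∃ τ > 0,
        (∀ k j, 0 ≤ q k j + τ * (σ * d (k, j))) ∧
        AlmostMixable C ε
          (fun k => uniformMixture (fun j => q k j + τ * (σ * d (k, j))) (t k)) := by
      intro σ hσ
      obtain ⟨τ, hτ, hnn, x, hx, hx0⟩ := exists_pos_add_mul_eq_zero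
        (q := fun x : ι × J => q x.1 x.2) (d := fun x => σ * d x) (fun x => h.nonneg _ _)
        (fun x hx => by rw [hsupp x hx, mul_zero]) hσ
      refine ⟨τ, hτ, fun k j => hnn (k, j), ih _ (hn ▸ Finset.card_lt_card ?_)
        ⟨fun k j => hnn (k, j), fun k => ?_, h.endpoint_nonneg, h.endpoint_le, ?_⟩ rfl⟩
      · rw [Finset.sum_add_distrib, ← Finset.mul_sum, ← Finset.mul_sum, hrow, h.sum_eq_one]
        ring
      · have : ∀ k, ∑ j, (q k j + τ * (σ * d (k, j))) * t k j
            = ∑ j, q k j * t k j + τ * σ * ∑ j, d (k, j) * t k j := fun k => by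
          rw [Finset.mul_sum, ← Finset.sum_add_distrib]
          exact Finset.sum_congr rfl fun j _ => by ring
        rw [Finset.sum_congr rfl fun k _ => this k, Finset.sum_add_distrib, ← Finset.mul_sum,
          hmean, h.sum_mean]
        ring
      · rw [Finset.ssubset_iff_of_subset]
        · exact ⟨x, by simpa using hx, by simpa using hx0⟩
        · intro y hy
          simp only [Finset.mem_filter, Finset.mem_univ, true_and] at hy ⊢
          intro h0
          exact hy (by rw [h0, hsupp y h0]; ring)
    obtain ⟨τ₁, hτ₁, hn₁, hm₁⟩ := hstep 1 (by simpa using hneg.1)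
    obtain ⟨τ₂, hτ₂, hn₂, hm₂⟩ := hstep (-1) (by simpa using hneg.2)
    have hτ : 0 < τ₁ + τ₂ := add_pos hτ₁ hτ₂
    have := AlmostMixable.convexCombo (J := Fin 2) (C := C) (ε := ![ε, ε])
      (p := ![τ₂ / (τ₁ + τ₂), τ₁ / (τ₁ + τ₂)])
      (μ := ![fun k => uniformMixture (fun j => q k j + τ₁ * (1 * d (k, j))) (t k),
        fun k => uniformMixture (fun j => q k j + τ₂ * (-1 * d (k, j))) (t k)])
      (κ := fun k => uniformMixture (q k) (t k))
      (fun i => by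
        fin_cases i
        · exact hm₁
        · exact hm₂)
      (fun i => by fin_cases i <;> simp <;> positivity)
      (by simp only [Fin.sum_univ_two, Matrix.cons_val_zero, Matrix.cons_val_one]; field_simp; ring)
      (fun k A hA => by
        simp only [Fin.sum_univ_two, Matrix.cons_val_zero, Matrix.cons_val_one]
        rw [uniformMixture_real (h.nonneg k), uniformMixture_real (hn₁ k),
          uniformMixture_real (hn₂ k), Finset.mul_sum, Finset.mul_sum,
          ← Finset.sum_add_distrib]
        refine Finset.sum_congr rfl fun j _ => ?_
        field_simp
        ring)
    refine this.mono (le_of_eq ?_)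
    simp only [Fin.sum_univ_two, Matrix.cons_val_zero, Matrix.cons_val_one]
    field_simp
    ring

theorem IsBalanced.almostMixable_inv {J : Type*} [Fintype J] {C : ℝ} {q t : ι → J → ℝ}
    (h : IsBalanced C q t) (n : ℕ) :
    AlmostMixable C (2 / (n + 2)) (fun k => uniformMixture (q k) (t k)) := by
  have hfin : ∀ n : ℕ, ∀ u v : ι → Fin 2 → ℝ, IsBalanced C u v →
      AlmostMixable C (2 / (n + 2)) (fun k => uniformMixture (u k) (v k)) := by
    intro n
    induction n with
    | zero =>
      intro u v h
      have := h.isProbabilityMeasure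
      simpa using almostMixable_one C (fun k => uniformMixture (u k) (v k))
    | succ n ih =>
      intro u v h
      refine h.almostMixable_of_isEdge (by positivity) fun k t b p q κ hκ =>
        (hκ.almostMixable_of_forall_isBalanced (by positivity) ?_ ih).mono ?_
      · rw [div_le_one (by positivity)]
        have := n.cast_nonneg (α := ℝ)
        linarith
      · push_cast
        rw [← sub_nonneg]
        have : (2 : ℝ) / (n + 1 + 2) - 2 / (n + 2) * (1 - 2 / (n + 2) / 2)
            = 2 / ((n + 3) * (n + 2) ^ 2) := by
          have : (n : ℝ) + 1 + 2 ≠ 0 := by positivity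
          field_simp
          ring
        rw [this]
        positivity
  refine h.almostMixable_of_isEdge (by positivity) fun k t b p q κ hκ => ?_
  refine (hκ.almostMixable_of_forall_isBalanced (by positivity) ?_ (hfin n)).mono ?_
  · rw [div_le_one (by positivity)]
    have := n.cast_nonneg (α := ℝ)
    linarith
  · have : (0 : ℝ) ≤ 2 / (n + 2) := by positivity
    nlinarith

end Coupling

section Limit
open Filter Topology
variable {ι : Type*} [Fintype ι]

theorem tendsto_of_real_le_cthickening {ν : ProbabilityMeasure ℝ} {κ : ℕ → ProbabilityMeasure ℝ}
    {δ : ℕ → ℝ} (hδ : Tendsto δ atTop (𝓝 0))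
    (h : ∀ n F, IsClosed F →
      (κ n : Measure ℝ).real F ≤ (ν : Measure ℝ).real (Metric.cthickening (δ n) F)) :
    Tendsto κ atTop (𝓝 ν) := by
  refine tendsto_of_forall_isClosed_limsup_real_le' fun F hF => ?_
  have h1 : Tendsto (fun n => (ν : Measure ℝ).real (Metric.cthickening (δ n) F)) atTop
      (𝓝 ((ν : Measure ℝ).real F)) :=
    (ENNReal.tendsto_toReal (measure_ne_top _ _)).comp
      ((tendsto_measure_cthickening_of_isClosed ⟨1, one_pos, measure_ne_top _ _⟩ hF).comp hδ)
  rw [← h1.limsup_eq]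
  refine limsup_le_limsup (Eventually.of_forall fun n => h n F hF) ?_ h1.isBoundedUnder_le
  exact (isBoundedUnder_of ⟨0, fun n => measureReal_nonneg⟩ :
    IsBoundedUnder (· ≥ ·) atTop fun n => (κ n : Measure ℝ).real F).isCoboundedUnder_le

/-- Approximate mixability passes to weak limits of uniformly compactly supported measures. -/
theorem almostMixable_zero_of_tendsto {ν : ι → ProbabilityMeasure ℝ}
    {κ : ℕ → ι → ProbabilityMeasure ℝ} {C L : ℝ} {c ε : ℕ → ℝ} (hc : Tendsto c atTop (𝓝 C))
    (hε : Tendsto ε atTop (𝓝 0)) (hL : ∀ n k, (κ n k : Measure ℝ) (Set.Icc 0 L)ᶜ = 0)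
    (hκ : ∀ n, AlmostMixable (c n) (ε n) (fun k => (κ n k : Measure ℝ)))
    (hlim : ∀ k, Tendsto (fun n => κ n k) atTop (𝓝 (ν k))) :
    AlmostMixable C 0 (fun k => (ν k : Measure ℝ)) := by
  choose γ hγ hmap hsum using hκ
  let G : ℕ → ProbabilityMeasure (ι → ℝ) := fun n => ⟨γ n, hγ n⟩
  have hS := isCompact_setOfPred_probabilityMeasure_mass_eq_compl_isCompact_le
    (E := ι → ℝ) (u := fun _ => 0) (K := fun _ => Set.Icc (fun _ => 0) (fun _ => L))
    tendsto_const_nhds (fun _ => isCompact_Icc) (Or.inl inferInstance)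
  have hGS : ∀ n, G n ∈ {μ : ProbabilityMeasure (ι → ℝ) |
      ∀ _ : ℕ, μ (Set.Icc (fun _ => 0) (fun _ => L))ᶜ ≤ 0} := by
    intro n _
    have h1 : ∀ᵐ x ∂γ n, ∀ k, x k ∈ Set.Icc 0 L := by
      refine ae_all_iff.2 fun k => ?_
      refine ae_of_ae_map (f := fun x : ι → ℝ => x k) (p := fun y => y ∈ Set.Icc 0 L)
        (measurable_pi_apply k).aemeasurable ?_
      rw [hmap]
      exact hL n k
    have h2 : γ n (Set.Icc (fun _ => 0) (fun _ => L))ᶜ = 0 := by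
      rw [← mem_ae_iff]
      filter_upwards [h1] with x hx using ⟨fun k => (hx k).1, fun k => (hx k).2⟩
    rw [← ENNReal.coe_le_coe, ProbabilityMeasure.ennreal_coeFn_eq_coeFn_toMeasure]
    exact h2.le
  obtain ⟨γ₀, -, hγ₀⟩ := hS.ultrafilter_le_nhds ((hyperfilter ℕ).map G) (by
    rw [Ultrafilter.coe_map, le_principal_iff]
    exact mem_map.2 (Eventually.of_forall hGS))
  have hlimG : Tendsto G (hyperfilter ℕ : Filter ℕ) (𝓝 γ₀) := hγ₀
  have hatTop : (hyperfilter ℕ : Filter ℕ) ≤ atTop := Nat.hyperfilter_le_atTop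
  refine ⟨γ₀, inferInstance, fun k => ?_, ?_⟩
  · have h1 := ProbabilityMeasure.tendsto_map_of_tendsto_of_continuous G γ₀ hlimG
      (continuous_apply k)
    have h2 : (fun n => (G n).map (continuous_apply k).measurable.aemeasurable)
        = fun n => κ n k := funext fun n => Subtype.ext (hmap n k)
    rw [h2] at h1
    exact congrArg (fun μ : ProbabilityMeasure ℝ => (μ : Measure ℝ))
      (tendsto_nhds_unique h1 ((hlim k).mono_left hatTop))
  · have hopen : ∀ m : ℕ,
        (γ₀ : Measure (ι → ℝ)) {x | 1 / ((m : ℝ) + 1) < |∑ i, x i - C|} = 0 := by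
      intro m
      have hm : (0 : ℝ) < 1 / (m + 1) := by positivity
      have h1 := ProbabilityMeasure.le_liminf_measure_open_of_tendsto hlimG
        (isOpen_lt continuous_const (by fun_prop) :
          IsOpen {x : ι → ℝ | 1 / ((m : ℝ) + 1) < |∑ i, x i - C|})
      have h2 : Tendsto (fun n => ENNReal.ofReal (ε n)) (hyperfilter ℕ : Filter ℕ) (𝓝 0) := by
        simpa using (ENNReal.tendsto_ofReal hε).mono_left hatTop
      refine le_antisymm (h1.trans ((liminf_le_liminf ?_).trans_eq h2.liminf_eq)) zero_le
      have h3 := (hc.mono_left hatTop).eventually (Metric.ball_mem_nhds C hm)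
      filter_upwards [h3] with n hn
      rw [Real.dist_eq] at hn
      refine (measure_mono fun x hx h => ?_).trans
        ((ENNReal.le_ofReal_iff_toReal_le (measure_ne_top _ _) ?_).2 (hsum n))
      · rw [Set.mem_ofPred_eq, h] at hx
        exact hx.not_gt hn
      · exact measureReal_nonneg.trans (hsum n)
    have : (γ₀ : Measure (ι → ℝ)) {x | ∑ i, x i ≠ C} = 0 := by
      refine measure_mono_null (fun x hx => ?_) (measure_iUnion_null hopen)
      obtain ⟨m, hm⟩ := exists_nat_one_div_lt (abs_pos.2 (sub_ne_zero.2 hx))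
      exact Set.mem_iUnion.2 ⟨m, hm⟩
    simp [Measure.real, this]

end Limit

section Discretization

/-- The measure `ν` has a nonincreasing density `f` on `(0, ∞)` which vanishes beyond `L`. -/
structure HasDecreasingDensity (ν : Measure ℝ) (f : ℝ → ℝ) (L : ℝ) : Prop where
  nonneg : ∀ x, 0 ≤ f x
  antitoneOn : AntitoneOn f (Set.Ici 0)
  eq_zero : ∀ x, L < x → f x = 0
  eq_withDensity : ν = (volume.restrict (Set.Ioi 0)).withDensity fun x => ENNReal.ofReal (f x)

namespace HasDecreasingDensity

variable {ν : Measure ℝ} {f : ℝ → ℝ} {L : ℝ}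

theorem measure_compl_Ioc (h : HasDecreasingDensity ν f L) : ν (Set.Ioc 0 L)ᶜ = 0 := by
  have hms : MeasurableSet (Set.Ioc 0 L)ᶜ := measurableSet_Ioc.compl
  rw [h.eq_withDensity, withDensity_apply _ hms, Measure.restrict_restrict hms]
  refine setLIntegral_eq_zero (hms.inter measurableSet_Ioi) fun x hx => ?_
  have : L < x := lt_of_not_ge fun hxL => hx.1 ⟨hx.2, hxL⟩
  simp [h.eq_zero x this]

theorem setIntegral_Ioc (h : HasDecreasingDensity ν f L) {a b : ℝ} (ha : 0 ≤ a) (g : ℝ → ℝ) :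
    ∫ x in Set.Ioc a b, g x ∂ν = ∫ x in Set.Ioc a b, f x * g x := by
  have hsub : Set.Ioc a b ⊆ Set.Ici 0 := fun x hx => ha.trans hx.1.le
  have hsub' : Set.Ioc a b ⊆ Set.Ioi 0 := fun x hx => ha.trans_lt hx.1
  have hm : AEMeasurable f ((volume.restrict (Set.Ioi 0)).restrict (Set.Ioc a b)) := by
    rw [Measure.restrict_restrict measurableSet_Ioc, Set.inter_eq_left.2 hsub']
    exact aemeasurable_restrict_of_antitoneOn measurableSet_Ioc (h.antitoneOn.mono hsub)
  rw [h.eq_withDensity, setIntegral_withDensity_eq_setIntegral_toReal_smul₀ hm.ennreal_ofReal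
    (by simp) _ measurableSet_Ioc, Measure.restrict_restrict measurableSet_Ioc,
    Set.inter_eq_left.2 hsub']
  simp [ENNReal.toReal_ofReal (h.nonneg _)]

theorem intervalIntegral_eq (h : HasDecreasingDensity ν f L) {a b : ℝ} (ha : 0 ≤ a) (hab : a ≤ b)
    (g : ℝ → ℝ) : ∫ x in a..b, g x ∂ν = ∫ x in a..b, f x * g x := by
  rw [intervalIntegral.integral_of_le hab, intervalIntegral.integral_of_le hab,
    h.setIntegral_Ioc ha]

theorem intervalIntegrable (h : HasDecreasingDensity ν f L) {a b : ℝ} (ha : 0 ≤ a)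
    (hab : a ≤ b) : IntervalIntegrable f volume a b := by
  apply AntitoneOn.intervalIntegrable
  rw [Set.uIcc_of_le hab]
  exact h.antitoneOn.mono fun x hx => ha.trans hx.1

theorem real_Ioc (h : HasDecreasingDensity ν f L) {a b : ℝ} (ha : 0 ≤ a) (hab : a ≤ b) :
    ν.real (Set.Ioc a b) = ∫ x in a..b, f x := by
  simpa [intervalIntegral.integral_of_le hab] using h.intervalIntegral_eq ha hab fun _ => 1

theorem real_Ioc_le (h : HasDecreasingDensity ν f L) {a b c : ℝ} (ha : 0 ≤ a) (hab : a ≤ b)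
    (hbc : c - b = b - a) : ν.real (Set.Ioc b c) ≤ ν.real (Set.Ioc a b) := by
  have hbc' : b ≤ c := by linarith
  have h1 : ∫ x in b..c, f x ≤ ∫ x in b..c, f b :=
    intervalIntegral.integral_mono_on hbc' (h.intervalIntegrable (ha.trans hab) hbc')
      (by simp) fun x hx => h.antitoneOn (ha.trans hab) ((ha.trans hab).trans hx.1) hx.1
  have h2 : ∫ x in a..b, f b ≤ ∫ x in a..b, f x :=
    intervalIntegral.integral_mono_on hab (by simp) (h.intervalIntegrable ha hab)
      fun x hx => h.antitoneOn (ha.trans hx.1) (ha.trans hab) hx.2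
  rw [h.real_Ioc ha hab, h.real_Ioc (ha.trans hab) hbc']
  simp only [intervalIntegral.integral_const, hbc] at h1 h2
  exact h1.trans h2

theorem integral_le_midpoint (h : HasDecreasingDensity ν f L) {a b : ℝ} (ha : 0 ≤ a)
    (hab : a ≤ b) : ∫ x in a..b, x ∂ν ≤ (a + b) / 2 * ν.real (Set.Ioc a b) := by
  set m := (a + b) / 2 with hm
  have hf := h.intervalIntegrable ha hab
  have h1 : ∫ x in a..b, f x * (x - m) ≤ ∫ x in a..b, f m * (x - m) := by
    refine intervalIntegral.integral_mono_on hab (hf.mul_continuousOn (by fun_prop))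
      (Continuous.intervalIntegrable (by fun_prop) _ _) fun x hx => ?_
    have hm0 : m ∈ Set.Ici (0 : ℝ) := Set.mem_Ici.2 (by linarith)
    have hx0 : x ∈ Set.Ici (0 : ℝ) := ha.trans hx.1
    rcases le_total x m with hxm | hxm
    · exact mul_le_mul_of_nonpos_right (h.antitoneOn hx0 hm0 hxm) (by linarith)
    · exact mul_le_mul_of_nonneg_right (h.antitoneOn hm0 hx0 hxm) (by linarith)
  have h2 : ∫ x in a..b, f m * (x - m) = 0 := by
    rw [intervalIntegral.integral_const_mul, intervalIntegral.integral_sub (by simp) (by simp)]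
    simp only [integral_id, intervalIntegral.integral_const, smul_eq_mul, hm]
    ring
  have h3 : ∫ x in a..b, f x * (x - m) = (∫ x in a..b, f x * x) - m * ∫ x in a..b, f x := by
    rw [← intervalIntegral.integral_const_mul, ← intervalIntegral.integral_sub
      (hf.mul_continuousOn (by fun_prop)) (hf.const_mul m)]
    congr 1
    ext x
    ring
  rw [h.real_Ioc ha hab, h.intervalIntegral_eq ha hab]
  linarith

theorem left_mul_le_integral (h : HasDecreasingDensity ν f L) {a b : ℝ} (ha : 0 ≤ a)
    (hab : a ≤ b) : a * ν.real (Set.Ioc a b) ≤ ∫ x in a..b, x ∂ν := by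
  have hf := h.intervalIntegrable ha hab
  rw [h.real_Ioc ha hab, h.intervalIntegral_eq ha hab, ← intervalIntegral.integral_const_mul]
  refine intervalIntegral.integral_mono_on hab (hf.const_mul a)
    (hf.mul_continuousOn (by fun_prop)) fun x hx => ?_
  rw [mul_comm]
  exact mul_le_mul_of_nonneg_left hx.1 (h.nonneg x)

theorem sum_intervalIntegral (h : HasDecreasingDensity ν f L) [IsProbabilityMeasure ν] {n : ℕ}
    {δ : ℝ} (hδ : 0 ≤ δ) (hn : n * δ = L) {g : ℝ → ℝ} (hg : Continuous g) :
    ∑ i ∈ Finset.range n, ∫ x in (i * δ)..((i + 1) * δ), g x ∂ν = ∫ x, g x ∂ν := by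
  have hL : 0 ≤ L := by rw [← hn]; positivity
  have := intervalIntegral.sum_integral_adjacent_intervals (f := g) (μ := ν) (n := n)
    (a := fun i => i * δ) fun i _ => hg.intervalIntegrable _ _
  push_cast at this
  rw [this, zero_mul, hn, intervalIntegral.integral_of_le hL,
    setIntegral_eq_integral_of_ae_compl_eq_zero]
  have h0 : ∀ᵐ x ∂ν, x ∈ Set.Ioc 0 L := h.measure_compl_Ioc
  filter_upwards [h0] with x hx hx' using absurd hx hx'

end HasDecreasingDensity

/-- Summation by parts. -/
theorem sum_sub_mul_succ (g U : ℕ → ℝ) (hU : U 0 = 0) (n : ℕ) :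
    ∑ j ∈ Finset.range n, (g j - g (j + 1)) * U (j + 1) + g n * U n
      = ∑ j ∈ Finset.range n, g j * (U (j + 1) - U j) := by
  induction n with
  | zero => simp [hU]
  | succ n ih =>
    rw [Finset.sum_range_succ, Finset.sum_range_succ]
    linear_combination ih

theorem segUnif_compl_Icc (c : ℝ) {s : ℝ} (hs : 0 ≤ s) :
    segUnif c s (Set.Icc c (c + s))ᶜ = 0 := by
  rw [segUnif, Measure.map_apply (by fun_prop) measurableSet_Icc.compl,
    Measure.restrict_apply (measurableSet_Icc.compl.preimage (by fun_prop))]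
  convert measure_empty (μ := (volume : Measure ℝ))
  ext x
  simp only [Set.mem_inter_iff, Set.mem_preimage, Set.mem_compl_iff, Set.mem_Icc,
    Set.mem_empty_iff_false, iff_false, not_and]
  intro h1 h2 h3
  exact h1 (by nlinarith) (by nlinarith)

/-- The masses given by `ν` to consecutive cells of length `δ`. -/
noncomputable def cellMass (ν : Measure ℝ) (δ : ℝ) (i : ℕ) : ℝ :=
  ν.real (Set.Ioc (i * δ) ((i + 1) * δ))

/-- The weights of a mixture of uniform distributions on the segments `[0, (j + 1) * δ]` giving the
same mass as `ν` to every cell of length `δ`. -/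
noncomputable def cellWeight (ν : Measure ℝ) (δ : ℝ) (j : ℕ) : ℝ :=
  (j + 1) * (cellMass ν δ j - cellMass ν δ (j + 1))

namespace HasDecreasingDensity

variable {ν : Measure ℝ} {f : ℝ → ℝ} {L δ : ℝ} {n : ℕ}

theorem cellWeight_nonneg (h : HasDecreasingDensity ν f L) (hδ : 0 ≤ δ) (j : ℕ) :
    0 ≤ cellWeight ν δ j := by
  refine mul_nonneg (by positivity) (sub_nonneg.2 ?_)
  unfold cellMass
  push_cast
  exact h.real_Ioc_le (by positivity) (by linarith) (by ring)

theorem sum_cellWeight_mul (h : HasDecreasingDensity ν f L) (hn : n * δ = L)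
    (V : ℕ → ℝ) : ∑ j : Fin n, cellWeight ν δ j * V (j + 1)
      = ∑ j ∈ Finset.range n, cellMass ν δ j * ((j + 1) * V (j + 1) - j * V j) := by
  have hg : cellMass ν δ n = 0 := by
    have : ν (Set.Ioc (n * δ) ((n + 1) * δ)) = 0 :=
      measure_mono_null (hn ▸ fun x hx hx' => hx.1.not_ge hx'.2) h.measure_compl_Ioc
    simp [cellMass, Measure.real, this]
  have := sum_sub_mul_succ (cellMass ν δ) (fun j => j * V j) (by simp) n
  rw [hg, zero_mul, add_zero] at this
  push_cast at this
  rw [← this, Fin.sum_univ_eq_sum_range (fun j => cellWeight ν δ j * V (j + 1))]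
  exact Finset.sum_congr rfl fun j _ => by unfold cellWeight; ring

theorem sum_cellMass (h : HasDecreasingDensity ν f L) [IsProbabilityMeasure ν] (hδ : 0 ≤ δ)
    (hn : n * δ = L) : ∑ j ∈ Finset.range n, cellMass ν δ j = 1 := by
  have := h.sum_intervalIntegral hδ hn (g := fun _ => (1 : ℝ)) continuous_const
  simp only [integral_const, probReal_univ, smul_eq_mul, mul_one] at this
  rw [← this]
  refine Finset.sum_congr rfl fun j _ => ?_
  rw [intervalIntegral.integral_of_le (by linarith)]
  simp [cellMass]

theorem sum_cellWeight (h : HasDecreasingDensity ν f L) [IsProbabilityMeasure ν] (hδ : 0 ≤ δ)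
    (hn : n * δ = L) : ∑ j : Fin n, cellWeight ν δ j = 1 := by
  rw [← h.sum_cellMass hδ hn]
  simpa using h.sum_cellWeight_mul hn fun _ => 1

theorem sum_cellWeight_mul_endpoint (h : HasDecreasingDensity ν f L) [IsProbabilityMeasure ν]
    (hδ : 0 ≤ δ) (hn : n * δ = L) :
    2 * ∫ x, x ∂ν ≤ ∑ j : Fin n, cellWeight ν δ j * (((j : ℕ) + 1) * δ) ∧
      ∑ j : Fin n, cellWeight ν δ j * (((j : ℕ) + 1) * δ) ≤ 2 * ∫ x, x ∂ν + δ := by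
  have h1 := h.sum_cellWeight_mul hn fun j => j * δ
  push_cast at h1
  rw [h1, ← h.sum_intervalIntegral hδ hn continuous_id', Finset.mul_sum]
  constructor
  · refine Finset.sum_le_sum fun j _ => ?_
    have := h.integral_le_midpoint (a := j * δ) (b := (j + 1) * δ) (by positivity) (by linarith)
    unfold cellMass
    linarith
  · calc _ ≤ ∑ j ∈ Finset.range n, (2 * (∫ x in (j * δ)..((j + 1) * δ), x ∂ν)
          + cellMass ν δ j * δ) := Finset.sum_le_sum fun j _ => ?_
      _ = _ := by rw [Finset.sum_add_distrib, ← Finset.sum_mul, h.sum_cellMass hδ hn, one_mul]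
    have := h.left_mul_le_integral (a := j * δ) (b := (j + 1) * δ) (by positivity) (by linarith)
    unfold cellMass
    linarith

/-- The approximation of `ν` by a mixture of uniform distributions giving the same mass to every
cell of length `δ`. -/
theorem uniformMixture_cellWeight_real_le (h : HasDecreasingDensity ν f L)
    [IsProbabilityMeasure ν] (hδ : 0 ≤ δ) (hn : n * δ = L) {F : Set ℝ} (hF : IsClosed F) :
    (uniformMixture (fun j : Fin n => cellWeight ν δ j) fun j => ((j : ℕ) + 1) * δ).real F
      ≤ ν.real (Metric.cthickening δ F) := by
  have h1 := h.sum_cellWeight_mul hn fun j => (segUnif 0 (j * δ)).real F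
  push_cast at h1
  rw [uniformMixture_real fun _ => h.cellWeight_nonneg hδ _, h1]
  have hT : MeasurableSet (Metric.cthickening δ F) := Metric.isClosed_cthickening.measurableSet
  have hcell : ∀ j : ℕ, cellMass ν δ j * ((j + 1) * (segUnif 0 ((j + 1) * δ)).real F
      - j * (segUnif 0 (j * δ)).real F)
      ≤ ν.real (Set.Ioc (j * δ) ((j + 1) * δ) ∩ Metric.cthickening δ F) := by
    intro j
    have hj : ((j : ℝ) + 1) ≠ 0 := by positivity
    have h2 := segUnif_split 0 ((j + 1) * δ) (j / (j + 1)) hF.measurableSet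
    have e1 : (j : ℝ) / (j + 1) * ((j + 1) * δ) = j * δ := by field_simp
    have e2 : (1 - (j : ℝ) / (j + 1)) * ((j + 1) * δ) = δ := by field_simp; ring
    rw [e1, e2, zero_add] at h2
    have h3 : (j + 1) * (segUnif 0 ((j + 1) * δ)).real F - j * (segUnif 0 (j * δ)).real F
        = (segUnif (j * δ) δ).real F := by
      rw [h2]
      field_simp
      ring
    rw [h3]
    by_cases hne : (Set.Icc (j * δ) (j * δ + δ) ∩ F).Nonempty
    · obtain ⟨y, hy, hyF⟩ := hne
      rw [Set.inter_eq_left.2 fun x hx => ?_]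
      · exact mul_le_of_le_one_right measureReal_nonneg measureReal_le_one
      · refine Metric.mem_cthickening_of_dist_le x y δ F hyF ?_
        rw [Real.dist_eq, abs_le]
        have h1 := hx.1
        have h2 := hx.2
        have h3 := hy.1
        have h4 := hy.2
        constructor <;> linarith
    · have : segUnif (j * δ) δ F = 0 :=
        measure_mono_null (fun x hx hx' => hne ⟨x, hx', hx⟩) (segUnif_compl_Icc _ hδ)
      simp [Measure.real, this]
  refine (Finset.sum_le_sum fun j _ => hcell j).trans ?_
  rw [← measureReal_biUnion_finset]
  · exact measureReal_mono (Set.iUnion₂_subset fun _ _ => Set.inter_subset_right)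
  · have hmono : Monotone fun j : ℕ => (j : ℝ) * δ := fun i j hij =>
      mul_le_mul_of_nonneg_right (Nat.cast_le.2 hij) hδ
    intro i _ j _ hij
    have := hmono.pairwise_disjoint_on_Ioc_succ hij
    simp only [Function.onFun, Nat.succ_eq_succ, Nat.succ_eq_add_one, Nat.cast_add,
      Nat.cast_one] at this
    exact this.mono Set.inter_subset_left Set.inter_subset_left
  · exact fun j _ => measurableSet_Ioc.inter hT

end HasDecreasingDensity

theorem uniformMixture_compl_Icc {J : Type*} [Fintype J] {q t : J → ℝ} {L : ℝ}
    (h0 : ∀ j, 0 ≤ t j) (hL : ∀ j, t j ≤ L) : uniformMixture q t (Set.Icc 0 L)ᶜ = 0 := by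
  simp only [uniformMixture, Measure.coe_finsetSum, Finset.sum_apply, Measure.smul_apply,
    smul_eq_mul]
  refine Finset.sum_eq_zero fun j _ => mul_eq_zero_of_right _ ?_
  refine measure_mono_null (Set.compl_subset_compl.2 (Set.Icc_subset_Icc_right ?_))
    (segUnif_compl_Icc 0 (h0 j))
  rw [zero_add]
  exact hL j

end Discretization

section Coupling
open Filter Topology
variable {ι : Type*} [Fintype ι]

/-- **Joint mixability of nonincreasing densities** on `[0, C]`, where `C` is the sum of the
means. -/
theorem almostMixable_of_hasDecreasingDensity {ν : ι → Measure ℝ}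
    [∀ k, IsProbabilityMeasure (ν k)] {f : ι → ℝ → ℝ} {C : ℝ} (hC0 : 0 ≤ C)
    (hC : ∑ k, ∫ x, x ∂ν k = C) (h : ∀ k, HasDecreasingDensity (ν k) (f k) C) :
    AlmostMixable C 0 ν := by
  let δ : ℕ → ℝ := fun n => C / (n + 1)
  have hδ : ∀ n, 0 ≤ δ n := fun n => by positivity
  have hn : ∀ n : ℕ, ((n + 1 : ℕ) : ℝ) * δ n = C := fun n => by
    simp only [δ]; push_cast; field_simp
  have hδlim : Tendsto δ atTop (𝓝 0) := by
    simpa [δ, div_eq_mul_one_div C] using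
      (tendsto_one_div_add_atTop_nhds_zero_nat (𝕜 := ℝ)).const_mul C
  let q : ∀ n : ℕ, ι → Fin (n + 1) → ℝ := fun n k j => cellWeight (ν k) (δ n) j
  let t : ∀ n : ℕ, ι → Fin (n + 1) → ℝ := fun n _ j => ((j : ℕ) + 1) * δ n
  let c : ℕ → ℝ := fun n => (∑ k, ∑ j, q n k j * t n k j) / 2
  have hCc : ∀ n, C ≤ c n := fun n => by
    have := Finset.sum_le_sum fun k (_ : k ∈ Finset.univ) =>
      ((h k).sum_cellWeight_mul_endpoint (hδ n) (hn n)).1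
    rw [← Finset.mul_sum, hC] at this
    simp only [c, q, t]
    linarith
  have hcC : ∀ n, c n ≤ C + Fintype.card ι / 2 * δ n := fun n => by
    have := Finset.sum_le_sum fun k (_ : k ∈ Finset.univ) =>
      ((h k).sum_cellWeight_mul_endpoint (hδ n) (hn n)).2
    rw [Finset.sum_add_distrib, ← Finset.mul_sum, hC, Finset.sum_const, nsmul_eq_mul,
      Finset.card_univ] at this
    simp only [c, q, t]
    linarith
  have ht0 : ∀ n k j, 0 ≤ t n k j := fun n k j => mul_nonneg (by positivity) (hδ n)
  have htC : ∀ n k j, t n k j ≤ C := fun n k j => by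
    rw [← hn n]
    exact mul_le_mul_of_nonneg_right (mod_cast j.2) (hδ n)
  have hbal : ∀ n, IsBalanced (c n) (q n) (t n) := fun n =>
    ⟨fun k j => (h k).cellWeight_nonneg (hδ n) j, fun k => (h k).sum_cellWeight (hδ n) (hn n),
      ht0 n, fun k j => (htC n k j).trans (hCc n), by simp only [c]; ring⟩
  refine almostMixable_zero_of_tendsto (L := C) (c := c) (ε := fun n => 2 / ((n : ℝ) + 2))
    (ν := fun k => ⟨ν k, inferInstance⟩)
    (κ := fun n k => ⟨uniformMixture (q n k) (t n k), (hbal n).isProbabilityMeasure k⟩)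
    ?_ ?_ (fun n k => uniformMixture_compl_Icc (ht0 n k) (htC n k))
    (fun n => (hbal n).almostMixable_inv n) fun k => tendsto_of_real_le_cthickening hδlim
      fun n F hF => (h k).uniformMixture_cellWeight_real_le (hδ n) (hn n) hF
  · refine tendsto_of_tendsto_of_tendsto_of_le_of_le tendsto_const_nhds ?_ hCc hcC
    simpa using (hδlim.const_mul _).const_add C
  · exact tendsto_const_nhds.div_atTop
      (tendsto_natCast_atTop_atTop.atTop_add tendsto_const_nhds)

theorem AlmostMixable.map_add {C ε : ℝ} {μ : ι → Measure ℝ} (h : AlmostMixable C ε μ)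
    (c : ι → ℝ) : AlmostMixable (C + ∑ k, c k) ε (fun k => (μ k).map (fun x => x + c k)) := by
  obtain ⟨γ, hγ, hmap, hsum⟩ := h
  have hT : Measurable fun (x : ι → ℝ) k => x k + c k := by fun_prop
  refine ⟨γ.map fun x k => x k + c k, Measure.isProbabilityMeasure_map hT.aemeasurable,
    fun k => ?_, ?_⟩
  · beta_reduce
    rw [← hmap k, Measure.map_map (by fun_prop) hT, Measure.map_map (by fun_prop) (by fun_prop)]
    rfl
  · have hs : MeasurableSet {x : ι → ℝ | ∑ i, x i ≠ C + ∑ k, c k} :=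
      (measurableSet_eq_fun (by fun_prop) (by fun_prop)).compl
    rw [map_measureReal_apply hT hs]
    convert hsum using 3
    ext x
    simp [Finset.sum_add_distrib]

end Coupling

theorem measure_compl_msupport (μ : Measure ℝ) : μ (msupport μ)ᶜ = 0 := by
  have hsub : (msupport μ)ᶜ ⊆ μ.supportᶜ := fun x hx hxs =>
    hx fun U hU hxU => ((Measure.mem_support_iff_forall x).1 hxs U (hU.mem_nhds hxU)).ne'
  exact measure_mono_null hsub Measure.measure_compl_support

theorem hasDecreasingDensity_map_sub {μ : Measure ℝ} {ρ : ℝ → ℝ} {l r L : ℝ}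
    (hd : μ = volume.withDensity fun x => ENNReal.ofReal (ρ x)) (hρ : ∀ x, 0 ≤ ρ x)
    (hmono : AntitoneOn ρ (Set.Icc l r)) (hlr : μ (Set.Icc l r)ᶜ = 0) (hL : r - l ≤ L) :
    HasDecreasingDensity (μ.map fun x => x - l)
      ((Set.Iic (r - l)).indicator fun x => ρ (x + l)) L where
  nonneg x := Set.indicator_nonneg (fun _ _ => hρ _) x
  antitoneOn x hx y hy hxy := by
    by_cases h : y ≤ r - l
    · rw [Set.indicator_of_mem (show y ∈ Set.Iic (r - l) from h),
        Set.indicator_of_mem (show x ∈ Set.Iic (r - l) from hxy.trans h)]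
      rw [Set.mem_Ici] at hx hy
      exact hmono ⟨by linarith, by linarith⟩ ⟨by linarith, by linarith⟩ (by linarith)
    · rw [Set.indicator_of_notMem (show y ∉ Set.Iic (r - l) from h)]
      exact Set.indicator_nonneg (fun _ _ => hρ _) x
  eq_zero x hx := Set.indicator_of_notMem (fun h => by
    rw [Set.mem_Iic] at h
    linarith) _
  eq_withDensity := by
    ext A hA
    have hsub : Measurable fun x : ℝ => x - l := by fun_prop
    have hI : (fun x => ENNReal.ofReal ((Set.Iic (r - l)).indicator (fun x => ρ (x + l)) x))
        = (Set.Iic (r - l)).indicator fun x => ENNReal.ofReal (ρ (x + l)) := by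
      ext x
      by_cases hx : x ∈ Set.Iic (r - l) <;> simp [hx]
    have hac : μ {l} = 0 := by
      rw [hd]
      exact withDensity_absolutelyContinuous _ _ (measure_singleton l)
    have hnull : ∀ᵐ x ∂μ, x - l ∈ Set.Iic (r - l) ∩ Set.Ioi 0 := by
      have h1 : ∀ᵐ x ∂μ, x ∈ Set.Icc l r := hlr
      have h2 : ∀ᵐ x ∂μ, x ≠ l := by rw [ae_iff]; simpa using hac
      filter_upwards [h1, h2] with x hx hxl
      have := lt_of_le_of_ne hx.1 hxl.symm
      exact ⟨Set.mem_Iic.2 (by linarith [hx.2]), Set.mem_Ioi.2 (by linarith)⟩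
    have hms : MeasurableSet (Set.Iic (r - l) ∩ (A ∩ Set.Ioi 0)) :=
      measurableSet_Iic.inter (hA.inter measurableSet_Ioi)
    rw [withDensity_apply _ hA, Measure.restrict_restrict hA, hI,
      setLIntegral_indicator measurableSet_Iic, Measure.map_apply hsub hA,
      ← (measurePreserving_sub_right volume l).setLIntegral_comp_preimage_emb
        (measurableEmbedding_subRight l)]
    simp only [sub_add_cancel]
    rw [← withDensity_apply _ (hsub hms), ← hd]
    refine measure_congr ?_
    filter_upwards [hnull] with x hx
    exact propext ⟨fun h => ⟨hx.1, h, hx.2⟩, fun h => h.2.1⟩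

/-- main theorem: for absolutely continuous probability measures μ_k with
support [l_k,r_k] and nonincreasing densities, a coupling concentrated on the hyperplane
{x₁+⋯+x_N = C}, C = Σ 𝔼(μ_k), exists iff r_k − l_k ≤ C − (l₁+⋯+l_N) for all k. -/
theorem stmt19 {N : ℕ} (μ : Fin N → Measure ℝ) (l r : Fin N → ℝ) (ρ : Fin N → ℝ → ℝ)
    (hprob : ∀ k, IsProbabilityMeasure (μ k))
    (hd : ∀ k, μ k = volume.withDensity (fun x => ENNReal.ofReal (ρ k x)))
    (hρpos : ∀ k x, 0 ≤ ρ k x)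
    (hmono : ∀ k, AntitoneOn (ρ k) (Set.Icc (l k) (r k)))
    (hsupp : ∀ k, msupport (μ k) = Set.Icc (l k) (r k))
    (C : ℝ) (hC : C = ∑ k, ∫ x, x ∂(μ k)) :
    (∃ γ : Measure (Fin N → ℝ), IsProbabilityMeasure γ ∧
        (∀ k, γ.map (fun x => x k) = μ k) ∧
        γ {x | (∑ i, x i) ≠ C} = 0)
    ↔ ∀ k, r k - l k ≤ C - ∑ i, l i := by
  have hnull : ∀ k, μ k (Set.Icc (l k) (r k))ᶜ = 0 := fun k => by
    rw [← hsupp k]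
    exact measure_compl_msupport _
  have hae : ∀ k, ∀ᵐ x ∂μ k, x ∈ Set.Icc (l k) (r k) := hnull
  have hlr : ∀ k, l k ≤ r k := fun k => by
    obtain ⟨x, hx⟩ := (hae k).exists
    exact hx.1.trans hx.2
  constructor
  · rintro ⟨γ, hγ, hmap, hsum⟩ k
    by_contra! hlt
    have hr : r k ∈ msupport (μ k) := by
      rw [hsupp k]
      exact ⟨hlr k, le_rfl⟩
    refine hr (Set.Ioi (C - ∑ i, l i + l k)) isOpen_Ioi (Set.mem_Ioi.2 (by linarith)) ?_
    have h1 : ∀ᵐ x ∂γ, ∀ i, l i ≤ x i := ae_all_iff.2 fun i => by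
      refine ae_of_ae_map (f := fun x : Fin N → ℝ => x i) (p := fun y => l i ≤ y)
        (measurable_pi_apply i).aemeasurable ?_
      rw [hmap]
      filter_upwards [hae i] with x hx using hx.1
    have h2 : ∀ᵐ x ∂γ, ∑ i, x i = C := hsum
    rw [← hmap k, Measure.map_apply (measurable_pi_apply k) measurableSet_Ioi,
      measure_eq_zero_iff_ae_notMem]
    filter_upwards [h1, h2] with x hx hxC hxk
    have h3 := Finset.single_le_sum (f := fun i => x i - l i)
      (fun i _ => sub_nonneg.2 (hx i)) (Finset.mem_univ k)
    rw [Finset.sum_sub_distrib, hxC] at h3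
    have h4 : C - ∑ i, l i + l k < x k := hxk
    linarith
  · intro hle
    have hint : ∀ k, Integrable (fun x => x) (μ k) := fun k =>
      Integrable.of_mem_Icc (l k) (r k) aemeasurable_id (hae k)
    have hprob' : ∀ k, IsProbabilityMeasure ((μ k).map fun x => x - l k) := fun k =>
      Measure.isProbabilityMeasure_map (by fun_prop)
    have hmean : ∑ k, ∫ x, x ∂(μ k).map (fun x => x - l k) = C - ∑ k, l k := by
      rw [hC, ← Finset.sum_sub_distrib]
      refine Finset.sum_congr rfl fun k _ => ?_
      rw [integral_map (by fun_prop) (by fun_prop), integral_sub (hint k) (by simp)]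
      simp
    have hpos : 0 ≤ C - ∑ k, l k := by
      rw [← hmean]
      refine Finset.sum_nonneg fun k _ => ?_
      rw [integral_map (by fun_prop) (by fun_prop)]
      exact integral_nonneg_of_ae ((hae k).mono fun x hx => sub_nonneg.2 hx.1)
    obtain ⟨γ, hγ, hmap, hsum⟩ := (almostMixable_of_hasDecreasingDensity hpos hmean fun k =>
      hasDecreasingDensity_map_sub (hd k) (hρpos k) (hmono k) (hnull k) (hle k)).map_add l
    refine ⟨γ, hγ, fun k => ?_, ?_⟩
    · rw [hmap]
      beta_reduce
      rw [Measure.map_map (by fun_prop) (by fun_prop)]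
      simp [Function.comp_def]
    · rw [sub_add_cancel] at hsum
      exact (measureReal_eq_zero_iff).1 (le_antisymm hsum measureReal_nonneg)
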